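/- arXiv:math/0502112 — 2 statements merged into one kernel-verified Lean document; each statement's English description precedes it below -/
import Mathlib

section
/- Let R̄ be a finite commutative ring with 1 and let d ≥ 2. Then every matrix in SL_d(R̄) can be written as a product of at most (3d² − d − 2)/2 elementary matrices E_{ij}(r) (i ≠ j, r ∈ R̄). -/
/-- The elementary matrix `E_{ij}(r)`: the identity matrix with the entry `r`
added in position `(i,j)`, as an element of `SL_d(A)`. -/
def elem {A : Type*} [CommRing A] {d : ℕ} (i j : Fin d) (h : i ≠ j) (r : A) :
    Matrix.SpecialLinearGroup (Fin d) A :=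
  ⟨Matrix.transvection i j r, Matrix.det_transvection_of_ne i j h r⟩

/-- A matrix in `SL_d(A)` is elementary if it is of the form `E_{ij}(r)` for some `i ≠ j`. -/
def IsElementary {A : Type*} [CommRing A] {d : ℕ}
    (g : Matrix.SpecialLinearGroup (Fin d) A) : Prop :=
  ∃ (i j : Fin d) (h : i ≠ j) (r : A), g = elem i j h r

open Matrix in
/-- `EL n M`: `M` is a product of exactly `n` transvections. -/
inductive EL {R : Type*} [CommRing R] {d : ℕ} : ℕ → Matrix (Fin d) (Fin d) R → Prop
  | one : EL 0 1
  | mul (n : ℕ) (M : Matrix (Fin d) (Fin d) R) (i j : Fin d) (r : R) :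
      i ≠ j → EL n M → EL (n + 1) (Matrix.transvection i j r * M)

section
variable {R : Type*} [CommRing R] {d : ℕ}

theorem EL.append {m n : ℕ} {A B : Matrix (Fin d) (Fin d) R} (hA : EL m A) (hB : EL n B) :
    EL (m + n) (A * B) := by
  induction hA with
  | one => simpa using hB
  | mul k M i j r h _ ih =>
    rw [Matrix.mul_assoc, show k + 1 + n = k + n + 1 by omega]
    exact EL.mul _ _ _ _ _ h ih

theorem EL.single (i j : Fin d) (h : i ≠ j) (r : R) : EL 1 (Matrix.transvection i j r) := by
  simpa using EL.mul 0 1 i j r h EL.one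

theorem EL.det {n : ℕ} {A : Matrix (Fin d) (Fin d) R} (hA : EL n A) : A.det = 1 := by
  induction hA with
  | one => simp
  | mul k M i j r h _ ih => rw [Matrix.det_mul, ih, Matrix.det_transvection_of_ne i j h, one_mul]

theorem EL.toList {n : ℕ} {A : Matrix (Fin d) (Fin d) R} (hA : EL n A) :
    ∃ L : List (Matrix.SpecialLinearGroup (Fin d) R), L.length = n ∧
      (∀ x ∈ L, IsElementary x) ∧ (L.prod : Matrix (Fin d) (Fin d) R) = A := by
  induction hA with
  | one => exact ⟨[], by simp⟩
  | mul k M i j r h _ ih =>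
    obtain ⟨L, h1, h2, h3⟩ := ih
    refine ⟨elem i j h r :: L, by simp [h1], ?_, ?_⟩
    · intro x hx
      rcases List.mem_cons.1 hx with rfl | hx
      · exact ⟨i, j, h, r, rfl⟩
      · exact h2 x hx
    · rw [List.prod_cons, Matrix.SpecialLinearGroup.coe_mul, h3]
      rfl

theorem EL.row (i : Fin d) (c : Fin d → R) (s : Finset (Fin d)) (hs : i ∉ s) :
    EL s.card (1 + ∑ j ∈ s, Matrix.single i j (c j)) := by
  induction s using Finset.induction_on with
  | empty => simpa using EL.one
  | insert a s ha ih =>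
    have hia : i ≠ a := by rintro rfl; simp at hs
    have his : i ∉ s := fun h => hs (Finset.mem_insert_of_mem h)
    rw [Finset.card_insert_of_notMem ha, Finset.sum_insert ha]
    convert EL.mul _ _ i a (c a) hia (ih his) using 1
    rw [Matrix.transvection, add_mul, one_mul, mul_add, mul_one, Finset.mul_sum,
      Finset.sum_eq_zero (s := s) (f := fun j => Matrix.single i a (c a) * Matrix.single i j (c j))]
    · abel
    · intro j _
      exact Matrix.single_mul_single_of_ne _ _ _ _ hia.symm _

theorem EL.col (i : Fin d) (c : Fin d → R) (s : Finset (Fin d)) (hs : i ∉ s) :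
    EL s.card (1 + ∑ j ∈ s, Matrix.single j i (c j)) := by
  induction s using Finset.induction_on with
  | empty => simpa using EL.one
  | insert a s ha ih =>
    have hia : a ≠ i := by rintro rfl; simp at hs
    have his : i ∉ s := fun h => hs (Finset.mem_insert_of_mem h)
    rw [Finset.card_insert_of_notMem ha, Finset.sum_insert ha]
    convert EL.mul _ _ a i (c a) hia (ih his) using 1
    rw [Matrix.transvection, add_mul, one_mul, mul_add, mul_one, Finset.mul_sum,
      Finset.sum_eq_zero (s := s) (f := fun j => Matrix.single a i (c a) * Matrix.single j i (c j))]
    · abel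
    · intro j hj
      refine Matrix.single_mul_single_of_ne _ _ _ _ ?_ _
      rintro rfl; exact his hj

/-- Block matrix with corner 1. -/
def phi (M : Matrix (Fin d) (Fin d) R) : Matrix (Fin (d + 1)) (Fin (d + 1)) R :=
  fun i j => Fin.cases (Fin.cases 1 (fun _ => 0) j) (fun i => Fin.cases 0 (fun j => M i j) j) i

@[simp] theorem phi_zz (M : Matrix (Fin d) (Fin d) R) : phi M 0 0 = 1 := rfl
@[simp] theorem phi_zs (M : Matrix (Fin d) (Fin d) R) (j) : phi M 0 (Fin.succ j) = 0 := rfl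
@[simp] theorem phi_sz (M : Matrix (Fin d) (Fin d) R) (j) : phi M (Fin.succ j) 0 = 0 := rfl
@[simp] theorem phi_ss (M : Matrix (Fin d) (Fin d) R) (i j) :
    phi M (Fin.succ i) (Fin.succ j) = M i j := rfl

theorem phi_mul (M N : Matrix (Fin d) (Fin d) R) : phi (M * N) = phi M * phi N := by
  ext i j
  refine Fin.cases ?_ (fun i => ?_) i <;> refine Fin.cases ?_ (fun j => ?_) j <;>
    simp [Matrix.mul_apply, Fin.sum_univ_succ]

theorem phi_one : phi (1 : Matrix (Fin d) (Fin d) R) = 1 := by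
  ext i j
  refine Fin.cases ?_ (fun i => ?_) i <;> refine Fin.cases ?_ (fun j => ?_) j <;>
    simp [Matrix.one_apply, Fin.succ_ne_zero, (Fin.succ_ne_zero _).symm]

theorem phi_transvection (i j : Fin d) (r : R) :
    phi (Matrix.transvection i j r) = Matrix.transvection i.succ j.succ r := by
  ext a b
  refine Fin.cases ?_ (fun a => ?_) a <;> refine Fin.cases ?_ (fun b => ?_) b <;>
    simp [Matrix.transvection, Matrix.one_apply, Matrix.single_apply, Fin.succ_ne_zero,
      (Fin.succ_ne_zero _).symm]

theorem phi_det (M : Matrix (Fin d) (Fin d) R) : (phi M).det = M.det := by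
  rw [Matrix.det_succ_row_zero, Fin.sum_univ_succ]
  simp
  rfl

theorem EL.phi {n : ℕ} {A : Matrix (Fin d) (Fin d) R} (hA : EL n A) : EL n (phi A) := by
  induction hA with
  | one => rw [phi_one]; exact EL.one
  | mul k M i j r h _ ih =>
    rw [phi_mul, phi_transvection]
    exact EL.mul _ _ _ _ _ (fun e => h (Fin.succ_injective _ e)) ih

theorem stable [Finite R] (x y b : R) (h : b * x + y = 1) : ∃ t, IsUnit (x + t * y) := by
  obtain ⟨m, n, hmn, hx⟩ := Finite.exists_ne_map_eq_of_infinite (fun k : ℕ => x ^ k)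
  wlog hlt : m < n generalizing m n
  · exact this n m hmn.symm hx.symm (by omega)
  refine ⟨1 - x ^ (n - m), ?_⟩
  by_contra hu
  obtain ⟨I, hI, hmem⟩ := exists_max_ideal_of_mem_nonunits hu
  have hp := hI.isPrime
  by_cases hxI : x ∈ I
  · have h1 : x ^ (n - m) ∈ I := Ideal.pow_mem_of_mem I hxI _ (by omega)
    apply hp.ne_top
    rw [Ideal.eq_top_iff_one]
    have : (1 : R) = b * x + ((x + (1 - x ^ (n - m)) * y) - x + y * x ^ (n - m)) := by
      linear_combination (-1 : R) * h
    rw [this]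
    exact I.add_mem (I.mul_mem_left _ hxI) (I.add_mem (I.sub_mem hmem hxI) (I.mul_mem_left _ h1))
  · have h0 : x ^ m * (1 - x ^ (n - m)) ∈ I := by
      have : x ^ m * (1 - x ^ (n - m)) = 0 := by
        rw [mul_sub, ← pow_add, show m + (n - m) = n by omega]
        simpa [sub_eq_zero] using hx
      rw [this]; exact I.zero_mem
    rcases hp.mem_or_mem h0 with h1 | h1
    · exact hxI (hp.mem_of_pow_mem _ h1)
    · apply hxI
      have := I.sub_mem hmem (I.mul_mem_right y h1)
      simpa using this

/-- A matrix with corner 1. -/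
theorem corner {n : ℕ} (M : Matrix (Fin (d + 1)) (Fin (d + 1)) R) (hM : M.det = 1)
    (h00 : M 0 0 = 1)
    (ih : ∀ K : Matrix (Fin d) (Fin d) R, K.det = 1 → EL n K) : EL (d + n + d) M := by
  let K : Matrix (Fin d) (Fin d) R := fun i j => M i.succ j.succ - M i.succ 0 * M 0 j.succ
  have hC := EL.col (0 : Fin (d + 1)) (fun j => M j 0) (Finset.univ.erase 0) (by simp)
  have hR := EL.row (0 : Fin (d + 1)) (fun j => M 0 j) (Finset.univ.erase 0) (by simp)
  have hcard : (Finset.univ.erase (0 : Fin (d + 1))).card = d := by simp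
  rw [hcard] at hC hR
  set C := (1 : Matrix (Fin (d + 1)) (Fin (d + 1)) R) +
    ∑ j ∈ Finset.univ.erase 0, Matrix.single j 0 (M j 0) with hCdef
  set T := (1 : Matrix (Fin (d + 1)) (Fin (d + 1)) R) +
    ∑ j ∈ Finset.univ.erase 0, Matrix.single 0 j (M 0 j) with hTdef
  have he : Finset.univ.erase (0 : Fin (d + 1)) = Finset.univ.map (Fin.succEmb d) := by
    ext x; refine Fin.cases ?_ (fun x => ?_) x <;> simp
  have hMe : M = C * phi K * T := by
    rw [hCdef, hTdef, he]
    ext i j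
    refine Fin.cases ?_ (fun i => ?_) i <;> refine Fin.cases ?_ (fun j => ?_) j <;>
      simp [Matrix.mul_apply, Fin.sum_univ_succ, Matrix.sum_apply, Matrix.one_apply,
        Matrix.single_apply, Fin.succ_ne_zero, (Fin.succ_ne_zero _).symm, h00]
    simp [K]
  have hK : K.det = 1 := by
    have := congrArg Matrix.det hMe
    rw [Matrix.det_mul, Matrix.det_mul, hC.det, hR.det, phi_det, hM] at this
    simpa using this.symm
  rw [hMe]
  exact (hC.append (ih K hK).phi).append hR

theorem step [Finite R] {n : ℕ} (M : Matrix (Fin (d + 2)) (Fin (d + 2)) R) (hM : M.det = 1)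
    (ih : ∀ K : Matrix (Fin (d + 1)) (Fin (d + 1)) R, K.det = 1 → EL n K) :
    EL ((d + 1) + (1 + ((d + 1) + n + (d + 1)))) M := by
  have h1 : (M.adjugate * M) 0 0 = 1 := by rw [Matrix.adjugate_mul, hM]; simp
  rw [Matrix.mul_apply, ← Finset.add_sum_erase _ _ (Finset.mem_univ (1 : Fin (d + 2)))] at h1
  obtain ⟨t, ht⟩ := stable _ _ _ h1
  let c : Fin (d + 2) → R := fun j => t * M.adjugate 0 j
  have hcard : (Finset.univ.erase (1 : Fin (d + 2))).card = d + 1 := by simp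
  have hA := EL.row (1 : Fin (d + 2)) (fun j => - c j) (Finset.univ.erase 1) (by simp)
  have hB := EL.row (1 : Fin (d + 2)) c (Finset.univ.erase 1) (by simp)
  rw [hcard] at hA
  set S := ∑ j ∈ Finset.univ.erase (1 : Fin (d + 2)), Matrix.single (1 : Fin (d + 2)) j (c j)
    with hS
  have hneg : ∑ j ∈ Finset.univ.erase (1 : Fin (d + 2)),
      Matrix.single (1 : Fin (d + 2)) j (- c j) = - S := by
    rw [hS, ← Finset.sum_neg_distrib]
    refine Finset.sum_congr rfl fun j _ => ?_
    ext a b; simp [Matrix.single_apply]; split_ifs <;> simp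
  have hSS : S * S = 0 := by
    rw [hS, Finset.sum_mul]
    refine Finset.sum_eq_zero fun j hj => ?_
    rw [Finset.mul_sum]
    refine Finset.sum_eq_zero fun k _ => ?_
    exact Matrix.single_mul_single_of_ne _ _ _ _ (Finset.ne_of_mem_erase hj) _
  rw [hneg] at hA
  have hinv : (1 + -S) * (1 + S) = 1 := by
    have : (1 + -S) * (1 + S) = 1 - S * S := by noncomm_ring
    rw [this, hSS, sub_zero]
  set N := (1 + S) * M with hN
  have hMN : M = (1 + -S) * N := by rw [hN, ← Matrix.mul_assoc, hinv, Matrix.one_mul]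
  have hNdet : N.det = 1 := by rw [hN, Matrix.det_mul, hB.det, hM, one_mul]
  have hN10 : N 1 0 = M 1 0 + t * ∑ j ∈ Finset.univ.erase 1, M.adjugate 0 j * M j 0 := by
    rw [hN, add_mul, one_mul, Matrix.add_apply, hS, Finset.sum_mul, Matrix.sum_apply,
      Finset.mul_sum]
    congr 1
    refine Finset.sum_congr rfl fun j _ => ?_
    simp [c, mul_assoc]
  rw [← hN10] at ht
  obtain ⟨u, hu⟩ := ht
  have h01 : (0 : Fin (d + 2)) ≠ 1 := by simp
  let r : R := (1 - N 0 0) * ↑u⁻¹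
  set P := Matrix.transvection 0 1 r * N with hP
  have hPdet : P.det = 1 := by
    rw [hP, Matrix.det_mul, hNdet, Matrix.det_transvection_of_ne _ _ h01, one_mul]
  have hP00 : P 0 0 = 1 := by
    rw [hP, Matrix.transvection_mul_apply_same, ← hu]
    simp [r, mul_assoc]
  have hNP : N = Matrix.transvection 0 1 (-r) * P := by
    rw [hP, ← Matrix.mul_assoc, Matrix.transvection_mul_transvection_same _ _ h01]
    simp
  rw [hMN]
  refine hA.append ?_
  rw [hNP]
  exact (EL.single _ _ h01 _).append (corner P hPdet hP00 ih)

theorem main_EL [Finite R] (d : ℕ) : ∀ M : Matrix (Fin (d + 1)) (Fin (d + 1)) R, M.det = 1 →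
    EL ((3 * (d + 1) ^ 2 - (d + 1) - 2) / 2) M := by
  induction d with
  | zero =>
    intro M hM
    have : M = 1 := by
      ext i j
      have hi : i = 0 := Fin.ext (by omega)
      have hj : j = 0 := Fin.ext (by omega)
      subst hi hj
      simpa using hM
    rw [this]; exact EL.one
  | succ d ih =>
    intro M hM
    convert step M hM ih using 1
    have e1 : 3 * (d + 1) ^ 2 = 3 * d ^ 2 + 6 * d + 3 := by ring
    have e2 : 3 * (d + 1 + 1) ^ 2 = 3 * d ^ 2 + 12 * d + 12 := by ring
    rw [e1, e2]
    omega

end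

/-- Every matrix in `SL_d(R̄)`, for `R̄` a finite commutative ring, is a product of at most
`(3d² − d − 2)/2` elementary matrices. -/
theorem elementary_bounded_generation_of_finite (R : Type*) [CommRing R] [Finite R]
    (d : ℕ) (hd : 2 ≤ d) (g : Matrix.SpecialLinearGroup (Fin d) R) :
    ∃ m : ℕ, m ≤ (3 * d ^ 2 - d - 2) / 2 ∧
      ∃ f : Fin m → Matrix.SpecialLinearGroup (Fin d) R,
        (∀ s, IsElementary (f s)) ∧ g = (List.ofFn f).prod := by
  obtain ⟨e, rfl⟩ : ∃ e, d = e + 1 := ⟨d - 1, by omega⟩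
  obtain ⟨L, h1, h2, h3⟩ := (main_EL e g.1 g.2).toList
  refine ⟨L.length, h1.le, L.get, fun s => h2 _ (List.get_mem _ _), ?_⟩
  rw [List.ofFn_get]
  exact Subtype.ext h3.symm
end

section
/- Let d ≥ 3, k ≥ 0, R = ℤ[x_1,…,x_k], and let H be a normal subgroup of finite index in SL_d(R). Define U = {r ∈ R : E_{12}(r) ∈ H}. Then U is an ideal of R of finite index (R/U is finite), and for every pair of distinct indices i,j ∈ {1,…,d} one has {r ∈ R : E_{ij}(r) ∈ H} = U. -/
theorem elem_mul {A : Type*} [CommRing A] {d : ℕ} (i j : Fin d) (h : i ≠ j) (r s : A) :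
    elem i j h r * elem i j h s = elem i j h (r + s) :=
  Subtype.ext (Matrix.transvection_mul_transvection_same i j h r s)

theorem elem_zero {A : Type*} [CommRing A] {d : ℕ} (i j : Fin d) (h : i ≠ j) :
    elem i j h (0 : A) = 1 :=
  Subtype.ext (Matrix.transvection_zero i j)

theorem elem_inv {A : Type*} [CommRing A] {d : ℕ} (i j : Fin d) (h : i ≠ j) (r : A) :
    (elem i j h r)⁻¹ = elem i j h (-r) := by
  rw [inv_eq_iff_mul_eq_one, elem_mul, add_neg_cancel, elem_zero]

theorem elem_comm {A : Type*} [CommRing A] {d : ℕ} (i j k : Fin d) (hij : i ≠ j) (hjk : j ≠ k)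
    (hik : i ≠ k) (r s : A) :
    elem i j hij r * elem j k hjk s * elem i j hij (-r) * elem j k hjk (-s)
      = elem i k hik (r * s) := by
  apply Subtype.ext
  change Matrix.transvection i j r * Matrix.transvection j k s * Matrix.transvection i j (-r) *
    Matrix.transvection j k (-s) = Matrix.transvection i k (r * s)
  simp only [Matrix.transvection, mul_add, add_mul, mul_one, one_mul,
    Matrix.single_mul_single_same, Matrix.single_mul_single_of_ne, ne_eq, hij, hjk, hik,
    hij.symm, hjk.symm, hik.symm, not_false_eq_true, zero_mul, add_zero, zero_add,
    mul_neg, neg_mul, neg_neg, ← Matrix.single_neg]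
  abel

section
variable {A : Type*} [CommRing A] {d : ℕ} (H : Subgroup (Matrix.SpecialLinearGroup (Fin d) A))

theorem exists_third (hd : 3 ≤ d) (i j : Fin d) : ∃ l : Fin d, l ≠ i ∧ l ≠ j := by
  obtain ⟨l, hl⟩ := Finset.exists_mem_notMem_of_card_lt_card
    (s := ({i, j} : Finset (Fin d))) (t := Finset.univ)
    (by have := Finset.card_le_two (a := i) (b := j); simp; omega)
  exact ⟨l, by simpa using hl⟩

theorem stepA0 (hN : H.Normal) (i j k : Fin d) (hij : i ≠ j) (hjk : j ≠ k) (hik : i ≠ k) (r s : A)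
    (h : elem i j hij r ∈ H) : elem i k hik (r * s) ∈ H := by
  rw [← elem_comm i j k hij hjk hik, ← elem_inv, ← elem_inv, mul_assoc, mul_assoc]
  refine H.mul_mem h ?_
  rw [← mul_assoc]
  exact hN.conj_mem _ (H.inv_mem h) _

theorem stepB0 (hN : H.Normal) (i j k : Fin d) (hij : i ≠ j) (hjk : j ≠ k) (hik : i ≠ k) (r s : A)
    (h : elem j k hjk s ∈ H) : elem i k hik (s * r) ∈ H := by
  rw [mul_comm, ← elem_comm i j k hij hjk hik, ← elem_inv, ← elem_inv]
  exact H.mul_mem (hN.conj_mem _ h _) (H.inv_mem h)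

theorem stepA (hd : 3 ≤ d) (hN : H.Normal) (i j k : Fin d) (hij : i ≠ j) (hik : i ≠ k) (r s : A)
    (h : elem i j hij r ∈ H) : elem i k hik (r * s) ∈ H := by
  by_cases hjk : j = k
  · subst hjk
    obtain ⟨l, hli, hlj⟩ := exists_third hd i j
    have := stepA0 H hN i j l hij hlj.symm hli.symm r 1 h
    rw [mul_one] at this
    exact stepA0 H hN i l j hli.symm hlj hij r s this
  · exact stepA0 H hN i j k hij hjk hik r s h

theorem stepAll (hd : 3 ≤ d) (hN : H.Normal) (i j i' j' : Fin d) (hij : i ≠ j) (hij' : i' ≠ j')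
    (r s : A) (h : elem i j hij r ∈ H) : elem i' j' hij' (r * s) ∈ H := by
  obtain ⟨l, hli, hli'⟩ := exists_third hd i i'
  have h1 := stepA H hd hN i j l hij hli.symm r 1 h
  rw [mul_one] at h1
  have h2 : elem i' l hli'.symm r ∈ H := by
    by_cases hii : i = i'
    · subst hii
      exact h1
    · have := stepB0 H hN i' i l (Ne.symm hii) hli.symm hli'.symm 1 r h1
      rwa [mul_one] at this
  exact stepA H hd hN i' l j' hli'.symm hij' r s h2

end

/-- Let `d ≥ 3`, `R = ℤ[x₁,…,x_k]`, and let `H` be a finite-index normal subgroup of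
`SL_d(R)`. Then `U := {r : R | E₁₂(r) ∈ H}` is an ideal of finite index in `R` and
`{r : R | E_{ij}(r) ∈ H} = U` for every pair of distinct indices `i ≠ j`. -/
theorem elementary_levels_form_ideal (d k : ℕ) (hd : 3 ≤ d)
    (H : Subgroup (Matrix.SpecialLinearGroup (Fin d) (MvPolynomial (Fin k) ℤ)))
    (hN : H.Normal) (hFI : H.FiniteIndex) :
    ∃ U : Ideal (MvPolynomial (Fin k) ℤ),
      (∀ r : MvPolynomial (Fin k) ℤ,
        r ∈ U ↔ elem (⟨0, by omega⟩ : Fin d) (⟨1, by omega⟩ : Fin d)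
          (by simp [Fin.ext_iff]) r ∈ H) ∧
      Finite (MvPolynomial (Fin k) ℤ ⧸ U) ∧
      ∀ (i j : Fin d) (hij : i ≠ j) (r : MvPolynomial (Fin k) ℤ),
        elem i j hij r ∈ H ↔ r ∈ U := by
  have h01 : (⟨0, by omega⟩ : Fin d) ≠ ⟨1, by omega⟩ := by simp [Fin.ext_iff]
  let U : Ideal (MvPolynomial (Fin k) ℤ) :=
    { carrier := {r | elem _ _ h01 r ∈ H}
      add_mem' := by
        intro a b ha hb
        have := H.mul_mem ha hb
        rwa [elem_mul] at this
      zero_mem' := by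
        change elem _ _ h01 0 ∈ H
        rw [elem_zero]
        exact H.one_mem
      smul_mem' := by
        intro c x hx
        change elem _ _ h01 (c * x) ∈ H
        rw [mul_comm]
        exact stepAll H hd hN _ _ _ _ h01 h01 x c hx }
  have hU : ∀ r, r ∈ U ↔ elem _ _ h01 r ∈ H := fun r => Iff.rfl
  refine ⟨U, hU, ?_, ?_⟩
  · have : Finite (Matrix.SpecialLinearGroup (Fin d) (MvPolynomial (Fin k) ℤ) ⧸ H) :=
      Subgroup.finite_quotient_of_finiteIndex
    refine Finite.of_injective (β := Matrix.SpecialLinearGroup (Fin d) (MvPolynomial (Fin k) ℤ) ⧸ H)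
      (fun q : MvPolynomial (Fin k) ℤ ⧸ U => QuotientGroup.mk (elem _ _ h01 (Quotient.out q))) ?_
    intro p q hpq
    have h1 := QuotientGroup.eq.1 hpq
    rw [elem_inv, elem_mul, ← hU] at h1
    have h2 : Ideal.Quotient.mk U (Quotient.out q) = Ideal.Quotient.mk U (Quotient.out p) := by
      rw [Ideal.Quotient.eq, sub_eq_neg_add]
      exact h1
    have e : ∀ x : MvPolynomial (Fin k) ℤ ⧸ U, Ideal.Quotient.mk U (Quotient.out x) = x :=
      fun x => Quotient.out_eq x
    rw [e, e] at h2
    exact h2.symm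
  · intro i j hij r
    rw [hU]
    constructor
    · intro h
      have := stepAll H hd hN _ _ _ _ hij h01 r 1 h
      rwa [mul_one] at this
    · intro h
      have := stepAll H hd hN _ _ _ _ h01 hij r 1 h
      rwa [mul_one] at this
end
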